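/- Let n ≥ 1 be an integer and D ≥ 1 a real. Let A be a symmetric stochastic n×n real matrix which is diagonally dominant (each diagonal entry a_{ii} is at least the sum of the off-diagonal entries of row i), and suppose for some pair i ≠ j one has a_{ij} ≥ 1/(8D). Let x ∈ ℝⁿ satisfy |x_i − x_j| ≥ (7/8) V2(x) / n^{1.5}. Then V2(Ax) ≤ (1 − 1/(50 n³ D)) V2(x). -/

import Mathlib

noncomputable section

/-- `V2(x) = sqrt(Σ_i (x_i - (1/n) Σ_j x_j)²)`. -/
def V2 {n : ℕ} (y : Fin n → ℝ) : ℝ :=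
  Real.sqrt (∑ i, (y i - (∑ j, y j) / n) ^ 2)

theorem V2_nonneg {n : ℕ} (y : Fin n → ℝ) : 0 ≤ V2 y :=
  Real.sqrt_nonneg _

open Matrix in
theorem V2_sq {n : ℕ} (hn : n ≠ 0) (y : Fin n → ℝ) :
    V2 y ^ 2 = y ⬝ᵥ y - (∑ i, y i) ^ 2 / n := by
  have hn' : (n : ℝ) ≠ 0 := Nat.cast_ne_zero.mpr hn
  rw [V2, Real.sq_sqrt (Finset.sum_nonneg fun _ _ => sq_nonneg _)]
  simp only [sub_sq, Finset.sum_add_distrib, Finset.sum_sub_distrib, ← Finset.sum_mul,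
    ← Finset.mul_sum, Finset.sum_const, Finset.card_univ, Fintype.card_fin, nsmul_eq_mul,
    dotProduct, ← pow_two]
  field_simp
  ring

open Matrix in
/-- The Dirichlet form of a symmetric matrix with unit row sums. -/
theorem dotProduct_self_sub_dotProduct_mulVec {n : ℕ} {B : Matrix (Fin n) (Fin n) ℝ}
    (hsym : B.IsSymm) (hrow : ∀ i, ∑ j, B i j = 1) (x : Fin n → ℝ) :
    2 * (x ⬝ᵥ x - x ⬝ᵥ B *ᵥ x) = ∑ k, ∑ l, B k l * (x k - x l) ^ 2 := by
  have h1 : ∑ k, ∑ l, B k l * x k ^ 2 = x ⬝ᵥ x := by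
    simp only [← Finset.sum_mul, hrow, one_mul, dotProduct, pow_two]
  have h2 : ∑ k, ∑ l, B k l * x l ^ 2 = x ⬝ᵥ x := by
    rw [Finset.sum_comm, ← h1]
    exact Finset.sum_congr rfl fun k _ => Finset.sum_congr rfl fun l _ => by rw [hsym.apply]
  have h3 : ∑ k, ∑ l, B k l * (x k * x l) = x ⬝ᵥ B *ᵥ x := by
    simp only [dotProduct, mulVec, Finset.mul_sum]
    exact Finset.sum_congr rfl fun k _ => Finset.sum_congr rfl fun l _ => by ring
  calc 2 * (x ⬝ᵥ x - x ⬝ᵥ B *ᵥ x)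
      = ∑ k, ∑ l, B k l * x k ^ 2 + ∑ k, ∑ l, B k l * x l ^ 2
          - 2 * ∑ k, ∑ l, B k l * (x k * x l) := by rw [h1, h2, h3]; ring
    _ = ∑ k, ∑ l, B k l * (x k - x l) ^ 2 := by
      simp only [Finset.mul_sum, ← Finset.sum_add_distrib, ← Finset.sum_sub_distrib]
      exact Finset.sum_congr rfl fun k _ => Finset.sum_congr rfl fun l _ => by ring

open Matrix in
theorem mul_sq_sub_le_dotProduct_self_sub {n : ℕ} {B : Matrix (Fin n) (Fin n) ℝ}
    (hsym : B.IsSymm) (hnn : ∀ i j, 0 ≤ B i j) (hrow : ∀ i, ∑ j, B i j = 1)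
    {i j : Fin n} (hij : i ≠ j) (x : Fin n → ℝ) :
    B i j * (x i - x j) ^ 2 ≤ x ⬝ᵥ x - x ⬝ᵥ B *ᵥ x := by
  have hterm : ∀ k l, 0 ≤ B k l * (x k - x l) ^ 2 := fun k l => mul_nonneg (hnn k l) (sq_nonneg _)
  have hrowterm : ∀ k l, B k l * (x k - x l) ^ 2 ≤ ∑ m, B k m * (x k - x m) ^ 2 := fun k l =>
    Finset.single_le_sum (f := fun m => B k m * (x k - x m) ^ 2) (fun m _ => hterm k m)
      (Finset.mem_univ l)
  have hpair := Finset.add_le_sum (f := fun k => ∑ l, B k l * (x k - x l) ^ 2)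
    (fun k _ => Finset.sum_nonneg fun l _ => hterm k l)
    (Finset.mem_univ i) (Finset.mem_univ j) hij
  rw [← dotProduct_self_sub_dotProduct_mulVec hsym hrow x] at hpair
  have h1 := hrowterm i j
  have h2 := hrowterm j i
  rw [hsym.apply i j, sub_sq_comm] at h2
  linarith

open Matrix in
theorem sum_mulVec_of_isSymm {n : ℕ} {A : Matrix (Fin n) (Fin n) ℝ} (hsym : A.IsSymm)
    (hrow : ∀ i, ∑ j, A i j = 1) (x : Fin n → ℝ) : ∑ i, (A *ᵥ x) i = ∑ i, x i := by
  simp only [mulVec, dotProduct]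
  rw [Finset.sum_comm]
  refine Finset.sum_congr rfl fun k _ => ?_
  rw [← Finset.sum_mul, Finset.sum_congr rfl fun l _ => (hsym.apply l k).symm, hrow, one_mul]

/-- Squaring does not decrease the off-diagonal entries of a nonnegative matrix whose diagonal
entries are at least `1 / 2`. -/
theorem apply_le_mul_self_apply {n : ℕ} {A : Matrix (Fin n) (Fin n) ℝ}
    (hnn : ∀ i j, 0 ≤ A i j) (hdiag : ∀ i, 1 / 2 ≤ A i i) {i j : Fin n} (hij : i ≠ j) :
    A i j ≤ (A * A) i j := by
  have h := Finset.add_le_sum (f := fun k => A i k * A k j)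
    (fun k _ => mul_nonneg (hnn i k) (hnn k j)) (Finset.mem_univ i) (Finset.mem_univ j) hij
  rw [Matrix.mul_apply]
  nlinarith [mul_le_mul_of_nonneg_right (hdiag i) (hnn i j),
    mul_le_mul_of_nonneg_left (hdiag j) (hnn i j)]

open Matrix in
theorem V2_mulVec_sq_le {n : ℕ} {A : Matrix (Fin n) (Fin n) ℝ} (hsym : A.IsSymm)
    (hnn : ∀ i j, 0 ≤ A i j) (hrow : ∀ i, ∑ j, A i j = 1)
    (hdiag : ∀ i, 1 / 2 ≤ A i i) {i j : Fin n} (hij : i ≠ j) (x : Fin n → ℝ) :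
    V2 (A *ᵥ x) ^ 2 ≤ V2 x ^ 2 - A i j * (x i - x j) ^ 2 := by
  have hn : n ≠ 0 := fun h => (h ▸ i).elim0
  have hsym2 : (A * A).IsSymm := by rw [IsSymm, transpose_mul, hsym.eq]
  have hrow2 : ∀ k, ∑ l, (A * A) k l = 1 := fun k => by
    simp only [mul_apply]
    rw [Finset.sum_comm]
    simp only [← Finset.mul_sum, hrow, mul_one]
  have hnn2 : ∀ k l, 0 ≤ (A * A) k l := fun k l => by
    rw [mul_apply]
    exact Finset.sum_nonneg fun m _ => mul_nonneg (hnn k m) (hnn m l)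
  have hdot : (A *ᵥ x) ⬝ᵥ (A *ᵥ x) = x ⬝ᵥ (A * A) *ᵥ x := by
    rw [← mulVec_mulVec, dotProduct_mulVec x, ← mulVec_transpose, hsym.eq]
  rw [V2_sq hn, V2_sq hn, sum_mulVec_of_isSymm hsym hrow, hdot]
  have h1 := mul_sq_sub_le_dotProduct_self_sub hsym2 hnn2 hrow2 hij x
  have h2 := mul_le_mul_of_nonneg_right (apply_le_mul_self_apply hnn hdiag hij)
    (sq_nonneg (x i - x j))
  linarith

/-- a symmetric stochastic diagonally dominant matrix with
`a_{ij} ≥ 1/(8D)` contracts `V2` by a factor `1 - 1/(50 n³ D)` when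
`|x_i - x_j| ≥ (7/8) V2(x)/n^{1.5}`. -/
theorem stmt18_variance_contraction {n : ℕ} (hn : 1 ≤ n) (D : ℝ) (hD : 1 ≤ D)
    (A : Matrix (Fin n) (Fin n) ℝ) (hsym : A.IsSymm)
    (hnn : ∀ i j, 0 ≤ A i j) (hrow : ∀ i, ∑ j, A i j = 1)
    (hdd : ∀ i, ∑ j ∈ Finset.univ.erase i, A i j ≤ A i i)
    (i j : Fin n) (hij : i ≠ j) (hA : 1 / (8 * D) ≤ A i j)
    (x : Fin n → ℝ) (hx : 7 / 8 * V2 x / (n : ℝ) ^ (1.5 : ℝ) ≤ |x i - x j|) :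
    V2 (A.mulVec x) ≤ (1 - 1 / (50 * (n : ℝ) ^ 3 * D)) * V2 x := by
  have hn0 : (1 : ℝ) ≤ n := by exact_mod_cast hn
  have hDn : 1 ≤ (n : ℝ) ^ 3 * D := one_le_mul_of_one_le_of_one_le (one_le_pow₀ hn0) hD
  have hV : 0 ≤ V2 x := V2_nonneg x
  have hdiag : ∀ k, 1 / 2 ≤ A k k := fun k => by
    have h := Finset.add_sum_erase Finset.univ (A k) (Finset.mem_univ k)
    linarith [hrow k, hdd k]
  have hpow : ((n : ℝ) ^ (1.5 : ℝ)) ^ 2 = (n : ℝ) ^ 3 := by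
    rw [← Real.rpow_natCast, ← Real.rpow_mul (by linarith), ← Real.rpow_natCast]
    norm_num
  have hgap : 49 / 64 * V2 x ^ 2 / (n : ℝ) ^ 3 ≤ (x i - x j) ^ 2 := by
    have h := pow_le_pow_left₀ (by positivity) hx 2
    rw [sq_abs, div_pow, hpow, mul_pow] at h
    norm_num at h ⊢
    exact h
  have hdrop : 49 / 512 * (1 / ((n : ℝ) ^ 3 * D)) * V2 x ^ 2 ≤ A i j * (x i - x j) ^ 2 := by
    refine le_trans (le_of_eq ?_) (mul_le_mul hA hgap (by positivity) (hnn i j))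
    field_simp
    ring
  have hmain := V2_mulVec_sq_le hsym hnn hrow hdiag hij x
  have hε : 1 / (50 * (n : ℝ) ^ 3 * D) = 1 / 50 * (1 / ((n : ℝ) ^ 3 * D)) := by
    field_simp
  have hε0 : 0 ≤ 1 / ((n : ℝ) ^ 3 * D) := by positivity
  have hε1 : 1 / ((n : ℝ) ^ 3 * D) ≤ 1 := (div_le_one (by linarith)).mpr hDn
  rw [hε]
  generalize 1 / ((n : ℝ) ^ 3 * D) = ε at *
  refine (sq_le_sq₀ (V2_nonneg _) (mul_nonneg (by linarith) hV)).mp ?_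
  nlinarith [mul_nonneg hε0 (sq_nonneg (V2 x)), mul_nonneg (sq_nonneg ε) (sq_nonneg (V2 x))]
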